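/- Fix n qubits, let U = ∏_{j=0}^{n-2} CZ_j be the cluster entangler, let ψ₊ be the plus-state vector, and let ψ = U *ᵥ ψ₊ be the cluster state. Let i ≥ 1 and m ≥ 0 with i + 2m + 1 ≤ n - 1, and let S = ∏_{k=0}^{m} X_{i+2k}. Then the string-order expectation value equals one: (star ψ) ⬝ᵥ ((Z_{i-1} * S * Z_{i+2m+1}) *ᵥ ψ) = 1. -/

import Mathlib

open Matrix

/-- The algebra of operators on `n` qubits: matrices indexed by configurations. -/
abbrev QubitOp (n : ℕ) := Matrix ((Fin n) → Fin 2) ((Fin n) → Fin 2) ℂ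

/-- The single-site operator acting as the `2 × 2` matrix `A` at site `j` and
trivially elsewhere. -/
noncomputable def siteOp {n : ℕ} (A : Matrix (Fin 2) (Fin 2) ℂ) (j : Fin n) :
    QubitOp n :=
  fun x y => A (x j) (y j) * ∏ k ∈ Finset.univ.erase j, (if x k = y k then (1 : ℂ) else 0)

/-- The Pauli `X` matrix. -/
def PauliX : Matrix (Fin 2) (Fin 2) ℂ := !![0, 1; 1, 0]

/-- The Pauli `Z` matrix. -/
def PauliZ : Matrix (Fin 2) (Fin 2) ℂ := !![1, 0; 0, -1]

/-- The controlled-Z gate acting on the (ordered) pair of sites `j`, `j'`. -/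
noncomputable def CZ {n : ℕ} (j j' : Fin n) : QubitOp n :=
  Matrix.diagonal (fun x => if x j = 1 ∧ x j' = 1 then (-1 : ℂ) else 1)

/-- The cluster entangler `U = ∏_{j=0}^{n-2} CZ_j` (ordered product of commuting
diagonal matrices). -/
noncomputable def clusterU (n : ℕ) : QubitOp n :=
  (((List.range (n - 1)).attach).map (fun j =>
    CZ (⟨j.1, by have := j.2; rw [List.mem_range] at this; omega⟩ : Fin n)
       (⟨j.1 + 1, by have := j.2; rw [List.mem_range] at this; omega⟩ : Fin n))).prod

/-- The string operator `S = ∏_{k=0}^{m} X_{i+2k}` (ordered product of commuting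
single-site Pauli `X` operators at the sites `i, i+2, …, i+2m`). -/
noncomputable def stringS (n i m : ℕ) (h : i + 2 * m + 1 ≤ n - 1) : QubitOp n :=
  (((List.range (m + 1)).attach).map (fun k =>
    siteOp PauliX
      (⟨i + 2 * k.1, by have := k.2; rw [List.mem_range] at this; omega⟩ : Fin n))).prod


/-- The plus-state vector `ψ₊(x) = (√2)⁻ⁿ` for every configuration `x`. -/
noncomputable def plusState (n : ℕ) : ((Fin n) → Fin 2) → ℂ :=
  fun _ => (((Real.sqrt 2)⁻¹ : ℝ) : ℂ) ^ n

open Finset in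
/-- A single-site operator acts on a vector by summing over the values at that site. -/
theorem siteOp_mulVec {n : ℕ} (A : Matrix (Fin 2) (Fin 2) ℂ) (j : Fin n)
    (v : (Fin n → Fin 2) → ℂ) (x : Fin n → Fin 2) :
    (siteOp A j *ᵥ v) x = ∑ b, A (x j) b * v (Function.update x j b) := by
  unfold Matrix.mulVec dotProduct siteOp
  symm
  refine sum_of_injOn (fun b => Function.update x j b) ?_ (by simp) ?_ ?_
  · exact (Function.update_injective x j).injOn
  · intro y _ hy
    obtain ⟨k, hk, hxy⟩ : ∃ k, k ≠ j ∧ x k ≠ y k := by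
      by_contra! hc
      refine hy ⟨y j, by simp, ?_⟩
      funext k
      by_cases hkj : k = j
      · subst hkj; simp
      · simp [hkj, hc k hkj]
    beta_reduce
    rw [prod_eq_zero (i := k) (by simp [hk]) (by simp [hxy])]
    simp
  · intro b _
    beta_reduce
    rw [prod_eq_one]
    · simp
    · intro k hk
      simp [ne_of_mem_erase hk]

/-- The eigenvalue of the Pauli `Z` matrix on a basis state. -/
def zSign (b : Fin 2) : ℂ := if b = 1 then -1 else 1

theorem siteOp_PauliZ_mulVec {n : ℕ} (j : Fin n) (v : (Fin n → Fin 2) → ℂ)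
    (x : Fin n → Fin 2) : (siteOp PauliZ j *ᵥ v) x = zSign (x j) * v x := by
  rw [siteOp_mulVec, Finset.sum_eq_single (x j)]
  · rw [Function.update_eq_self]
    congr 1
    generalize x j = b
    fin_cases b <;> simp [PauliZ, zSign]
  · intro b _ hb
    generalize x j = c at hb
    fin_cases b <;> fin_cases c <;> simp_all [PauliZ]
  · simp

theorem siteOp_PauliX_mulVec {n : ℕ} (j : Fin n) (v : (Fin n → Fin 2) → ℂ)
    (x : Fin n → Fin 2) :
    (siteOp PauliX j *ᵥ v) x = v (Function.update x j (x j + 1)) := by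
  rw [siteOp_mulVec, Finset.sum_eq_single (x j + 1)]
  · generalize x j = b
    fin_cases b <;> simp [PauliX]
  · intro b _ hb
    generalize x j = c at hb
    fin_cases b <;> fin_cases c <;> simp_all [PauliX]
  · simp

theorem zSign_mul_self (b : Fin 2) : zSign b * zSign b = 1 := by
  unfold zSign; split <;> norm_num

/-- The diagonal entry of the controlled-Z gate on two basis states. -/
def czSign (b c : Fin 2) : ℂ := if b = 1 ∧ c = 1 then -1 else 1

theorem czSign_add_one_left (b c : Fin 2) : czSign (b + 1) c = czSign b c * zSign c := by
  fin_cases b <;> fin_cases c <;> simp [czSign, zSign]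

theorem czSign_add_one_right (b c : Fin 2) : czSign b (c + 1) = czSign b c * zSign b := by
  fin_cases b <;> fin_cases c <;> simp [czSign, zSign]

theorem star_czSign_mul_self (b c : Fin 2) : star (czSign b c) * czSign b c = 1 := by
  unfold czSign; split <;> simp

/-- A configuration extended by zero to all natural numbers. -/
def extendConfig {n : ℕ} (x : Fin n → Fin 2) (k : ℕ) : Fin 2 :=
  if h : k < n then x ⟨k, h⟩ else 0

theorem extendConfig_of_lt {n : ℕ} (x : Fin n → Fin 2) {k : ℕ} (h : k < n) :
    extendConfig x k = x ⟨k, h⟩ := dif_pos h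

theorem extendConfig_update {n : ℕ} (x : Fin n → Fin 2) (a : Fin n) (b : Fin 2) :
    extendConfig (Function.update x a b) = Function.update (extendConfig x) a b := by
  funext k
  by_cases hk : k < n
  · by_cases hka : k = a
    · subst hka; simp [extendConfig]
    · have : (⟨k, hk⟩ : Fin n) ≠ a := fun h => hka (by rw [← h])
      simp [extendConfig, hk, hka, this]
  · have : k ≠ a := fun h => hk (h ▸ a.2)
    simp [extendConfig, hk, this]

/-- The diagonal entries of the cluster entangler. -/
noncomputable def clusterSign {n : ℕ} (x : Fin n → Fin 2) : ℂ :=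
  ∏ j ∈ Finset.range (n - 1), czSign (extendConfig x j) (extendConfig x (j + 1))

theorem clusterU_eq_diagonal (n : ℕ) : clusterU n = Matrix.diagonal clusterSign := by
  have key (l : List ℕ) : (l.map fun j => (Matrix.diagonal fun x : Fin n → Fin 2 =>
      czSign (extendConfig x j) (extendConfig x (j + 1)) : QubitOp n)).prod =
      Matrix.diagonal fun x =>
        (l.map fun j => czSign (extendConfig x j) (extendConfig x (j + 1))).prod := by
    induction l with
    | nil => simp
    | cons a l ih => simp [ih]
  have hprod : (clusterSign : (Fin n → Fin 2) → ℂ) = fun x =>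
      ((List.range (n - 1)).map fun j =>
        czSign (extendConfig x j) (extendConfig x (j + 1))).prod := by
    funext x
    rw [clusterSign, ← List.prod_toFinset _ List.nodup_range, List.toFinset_range]
  rw [hprod, ← key, clusterU, ← List.attach_map_val (l := List.range (n - 1))]
  congr 1
  refine List.map_congr_left fun j _ => ?_
  have hj := List.mem_range.1 j.2
  unfold CZ
  congr 1
  funext x
  rw [extendConfig_of_lt x (by omega : j.1 < n), extendConfig_of_lt x (by omega : j.1 + 1 < n)]
  rfl

/-- Flipping a bulk site `a` multiplies the cluster sign by the `Z` signs of its neighbours. -/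
theorem clusterSign_flip {n a : ℕ} (ha : 1 ≤ a) (han : a + 1 < n) (x : Fin n → Fin 2) :
    clusterSign (Function.update x ⟨a, by omega⟩ (x ⟨a, by omega⟩ + 1)) =
      clusterSign x * zSign (x ⟨a + 1, han⟩) * zSign (x ⟨a - 1, by omega⟩) := by
  have key (j : ℕ) :
      czSign (Function.update (extendConfig x) a (extendConfig x a + 1) j)
          (Function.update (extendConfig x) a (extendConfig x a + 1) (j + 1)) =
        czSign (extendConfig x j) (extendConfig x (j + 1)) *
          (if j = a then zSign (extendConfig x (a + 1)) else 1) *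
          (if j = a - 1 then zSign (extendConfig x (a - 1)) else 1) := by
    by_cases h1 : j = a
    · subst h1
      simp [czSign_add_one_left, show j ≠ j - 1 by omega]
    by_cases h2 : j = a - 1
    · obtain rfl : a = j + 1 := by omega
      simp [czSign_add_one_right]
    simp [h1, h2, show j + 1 ≠ a by omega]
  unfold clusterSign
  rw [extendConfig_update, ← extendConfig_of_lt x (by omega : a < n),
    Finset.prod_congr rfl fun j _ => key j, Finset.prod_mul_distrib, Finset.prod_mul_distrib,
    Finset.prod_ite_eq', Finset.prod_ite_eq', if_pos (by simp; omega), if_pos (by simp; omega),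
    extendConfig_of_lt x han, extendConfig_of_lt x (by omega : a - 1 < n)]

theorem clusterState_apply (n : ℕ) (x : Fin n → Fin 2) :
    (clusterU n *ᵥ plusState n) x = clusterSign x * (((Real.sqrt 2)⁻¹ : ℝ) : ℂ) ^ n := by
  rw [clusterU_eq_diagonal, Matrix.mulVec_diagonal]
  rfl

theorem star_clusterSign_mul_self {n : ℕ} (x : Fin n → Fin 2) :
    star (clusterSign x) * clusterSign x = 1 := by
  rw [clusterSign, star_prod, ← Finset.prod_mul_distrib]
  exact Finset.prod_eq_one fun j _ => star_czSign_mul_self _ _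

theorem clusterState_normalized (n : ℕ) :
    star (clusterU n *ᵥ plusState n) ⬝ᵥ (clusterU n *ᵥ plusState n) = 1 := by
  have hsqrt : (((Real.sqrt 2)⁻¹ : ℝ) : ℂ) * (((Real.sqrt 2)⁻¹ : ℝ) : ℂ) = 2⁻¹ := by
    rw [← Complex.ofReal_mul, ← mul_inv, Real.mul_self_sqrt (by norm_num)]
    norm_num
  have hterm (x : Fin n → Fin 2) : star (clusterU n *ᵥ plusState n) x *
      (clusterU n *ᵥ plusState n) x = 2⁻¹ ^ n := by
    rw [Pi.star_apply, clusterState_apply, star_mul', star_pow, mul_mul_mul_comm,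
      star_clusterSign_mul_self, ← mul_pow, Complex.star_def, Complex.conj_ofReal, hsqrt, one_mul]
  simp [dotProduct, -Pi.star_apply, hterm]

/-- The stabilizer relation of the cluster state at a bulk site `a`. -/
theorem siteOp_PauliX_PauliZ_clusterState {n a : ℕ} (ha : 1 ≤ a) (han : a + 1 < n) :
    siteOp PauliX (⟨a, by omega⟩ : Fin n) *ᵥ
        (siteOp PauliZ ⟨a + 1, han⟩ *ᵥ (clusterU n *ᵥ plusState n)) =
      siteOp PauliZ ⟨a - 1, by omega⟩ *ᵥ (clusterU n *ᵥ plusState n) := by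
  funext x
  rw [siteOp_PauliX_mulVec, siteOp_PauliZ_mulVec, siteOp_PauliZ_mulVec, clusterState_apply,
    clusterState_apply, clusterSign_flip ha han,
    Function.update_of_ne (by simp)]
  linear_combination (clusterSign x * zSign (x ⟨a - 1, by omega⟩) *
    (((Real.sqrt 2)⁻¹ : ℝ) : ℂ) ^ n) * zSign_mul_self (x ⟨a + 1, han⟩)

theorem siteOp_PauliZ_mulVec_self {n : ℕ} (j : Fin n) (v : (Fin n → Fin 2) → ℂ) :
    siteOp PauliZ j *ᵥ (siteOp PauliZ j *ᵥ v) = v := by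
  funext x
  rw [siteOp_PauliZ_mulVec, siteOp_PauliZ_mulVec, ← mul_assoc, zSign_mul_self, one_mul]

theorem stringS_succ (n i m : ℕ) (h : i + 2 * (m + 1) + 1 ≤ n - 1) :
    stringS n i (m + 1) h = stringS n i m (by omega) *
      siteOp PauliX (⟨i + 2 * (m + 1), by omega⟩ : Fin n) := by
  have key (m : ℕ) (h : i + 2 * m + 1 ≤ n - 1) : stringS n i m h =
      ((List.range (m + 1)).map fun k => if hk : i + 2 * k < n then
        siteOp PauliX (⟨i + 2 * k, hk⟩ : Fin n) else 1).prod := by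
    rw [stringS, ← List.attach_map_val (l := List.range (m + 1))]
    congr 1
    refine List.map_congr_left fun k _ => ?_
    have hk := List.mem_range.1 k.2
    rw [dif_pos (by omega)]
  rw [key, key, List.range_succ, List.map_append, List.prod_append, List.map_singleton,
    List.prod_singleton, dif_pos (by omega)]

/-- The string operator moves a `Z` from its right end to its left end on the cluster state. -/
theorem stringS_PauliZ_clusterState {n i m : ℕ} (hi : 1 ≤ i) (h : i + 2 * m + 1 ≤ n - 1)
    (hl : i - 1 < n) (hr : i + 2 * m + 1 < n) :
    stringS n i m h *ᵥ (siteOp PauliZ (⟨i + 2 * m + 1, hr⟩ : Fin n) *ᵥ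
        (clusterU n *ᵥ plusState n)) =
      siteOp PauliZ (⟨i - 1, hl⟩ : Fin n) *ᵥ (clusterU n *ᵥ plusState n) := by
  induction m with
  | zero =>
    have hS : stringS n i 0 h = siteOp PauliX (⟨i, by omega⟩ : Fin n) := by
      simp [stringS]
    rw [hS]
    exact siteOp_PauliX_PauliZ_clusterState hi hr
  | succ m ih =>
    rw [stringS_succ, ← Matrix.mulVec_mulVec,
      siteOp_PauliX_PauliZ_clusterState (by omega) (by omega)]
    exact ih (by omega) (by omega)

/-- The cluster state `ψ = U ψ₊` exhibits perfect string order: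
`⟨ψ, Z_{i-1} S Z_{i+2m+1} ψ⟩ = 1` where `S = ∏_{k=0}^{m} X_{i+2k}`,
for `i ≥ 1`, `m ≥ 0` with `i + 2m + 1 ≤ n - 1`. -/
theorem statement9
    (n i m : ℕ) (hi : 1 ≤ i) (h : i + 2 * m + 1 ≤ n - 1) :
    (star (clusterU n *ᵥ plusState n)) ⬝ᵥ
      ((siteOp PauliZ (⟨i - 1, by omega⟩ : Fin n) * stringS n i m h *
        siteOp PauliZ (⟨i + 2 * m + 1, by omega⟩ : Fin n)) *ᵥ
          (clusterU n *ᵥ plusState n)) = 1 := by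
  rw [← Matrix.mulVec_mulVec, ← Matrix.mulVec_mulVec, stringS_PauliZ_clusterState hi h (by omega),
    siteOp_PauliZ_mulVec_self, clusterState_normalized]
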